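/- arXiv:1711.11173 — 4 statements merged into one kernel-verified Lean document; each statement's English description precedes it below -/
import Mathlib

section
/- Let G be a finite group. Then G is not cyclic if and only if for every a ∈ G there exists an irreducible nontrivial complex representation π of G such that π(a) has 1 as an eigenvalue (i.e., there is a nonzero vector v with π(a)v = v). -/
/-- The left ideal of the group algebra generated by `a - 1` and the norm element is proper
unless `a` generates the group. -/
theorem MonoidAlgebra.span_sub_one_sum_ne_top {G : Type*} [Group G] [Fintype G] (a : G)
    (ha : Subgroup.zpowers a ≠ ⊤) :
    Ideal.span {MonoidAlgebra.of ℂ G a - 1, ∑ g : G, MonoidAlgebra.of ℂ G g} ≠ ⊤ := by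
  classical
  set H := Subgroup.zpowers a
  let c : ℂ := (Nat.card H : ℂ) / Nat.card G
  let f : G → ℂ := fun g => (if g ∈ H then 1 else 0) - c
  let φ : MonoidAlgebra ℂ G →+ ℂ :=
    MonoidAlgebra.liftNC (AddMonoidHom.id ℂ) f
  have hφ (r : ℂ) (g : G) : φ (MonoidAlgebra.single g r) = r * f g :=
    MonoidAlgebra.liftNC_single _ _ _ _
  have hG : (Nat.card G : ℂ) ≠ 0 := Nat.cast_ne_zero.mpr Nat.card_pos.ne'
  have hsum : ∑ g, f g = 0 := by
    have hH : ((Finset.univ.filter (· ∈ H)).card : ℂ) = Nat.card H := by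
      rw [Nat.card_eq_fintype_card, Fintype.card_subtype]
    simp only [f, Finset.sum_sub_distrib, Finset.sum_boole, Finset.sum_const, Finset.card_univ,
      hH, c, ← Nat.card_eq_fintype_card, nsmul_eq_mul]
    field_simp
    simp
  have hfa (g : G) : f (g * a) = f g := by
    simp only [f, H.mul_mem_cancel_right (Subgroup.mem_zpowers a)]
  have hxa (x : MonoidAlgebra ℂ G) : φ (x * (MonoidAlgebra.of ℂ G a - 1)) = 0 := by
    induction x using MonoidAlgebra.induction_linear with
    | zero => simp
    | add x y hx hy => rw [add_mul, map_add, hx, hy, add_zero]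
    | single g r =>
      rw [mul_sub, mul_one, map_sub, MonoidAlgebra.of_apply, MonoidAlgebra.single_mul_single,
        hφ, hφ, hfa, mul_one, sub_self]
  have hxN (x : MonoidAlgebra ℂ G) : φ (x * ∑ g : G, MonoidAlgebra.of ℂ G g) = 0 := by
    induction x using MonoidAlgebra.induction_linear with
    | zero => simp
    | add x y hx hy => rw [add_mul, map_add, hx, hy, add_zero]
    | single g r =>
      simp only [Finset.mul_sum, map_sum, MonoidAlgebra.of_apply,
        MonoidAlgebra.single_mul_single, hφ, mul_one]
      rw [← Finset.mul_sum, Fintype.sum_equiv (Equiv.mulLeft g) (fun h => f (g * h)) f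
        (fun _ => rfl), hsum, mul_zero]
  rw [Ideal.ne_top_iff_one]
  intro h
  obtain ⟨x, y, hxy⟩ := Ideal.mem_span_pair.mp h
  have h1 : φ 1 = 0 := by rw [← hxy, map_add, hxa, hxN, add_zero]
  rw [MonoidAlgebra.one_def, hφ, one_mul] at h1
  simp only [f, one_mem, if_true, c] at h1
  rw [sub_eq_zero, eq_comm, div_eq_one_iff_eq hG] at h1
  exact ha (Subgroup.eq_top_of_card_eq H (by exact_mod_cast h1))

/-- A simple module over the group algebra, written as a representation on `Fin n → ℂ`. -/
theorem MonoidAlgebra.exists_irreducible_rep_of_isSimpleModule {G M : Type*} [Group G]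
    [AddCommGroup M] [Module ℂ M] [Module (MonoidAlgebra ℂ G) M]
    [IsScalarTower ℂ (MonoidAlgebra ℂ G) M] [FiniteDimensional ℂ M]
    [IsSimpleModule (MonoidAlgebra ℂ G) M] :
    ∃ (n : ℕ) (π : G →* ((Fin n → ℂ) →ₗ[ℂ] (Fin n → ℂ))) (e : M ≃ₗ[ℂ] (Fin n → ℂ)),
      0 < n ∧
      (∀ V : Submodule ℂ (Fin n → ℂ), (∀ g : G, ∀ v ∈ V, π g v ∈ V) → V = ⊥ ∨ V = ⊤) ∧
      ∀ g m, π g (e m) = e (MonoidAlgebra.of ℂ G g • m) := by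
  have := IsSimpleModule.nontrivial (MonoidAlgebra ℂ G) M
  let e := (Module.finBasis ℂ M).equivFun
  let π : G →* ((Fin (Module.finrank ℂ M) → ℂ) →ₗ[ℂ] (Fin (Module.finrank ℂ M) → ℂ)) :=
    { toFun g := e.conj (Algebra.lsmul ℂ ℂ M (MonoidAlgebra.of ℂ G g))
      map_one' := by rw [map_one, map_one, Module.End.one_eq_id, LinearEquiv.conj_id]; rfl
      map_mul' g h := by rw [map_mul, map_mul, Module.End.mul_eq_comp, LinearEquiv.conj_comp]; rfl }
  have hπ (g : G) (m : M) : π g (e m) = e (MonoidAlgebra.of ℂ G g • m) := by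
    simp [π, LinearEquiv.conj_apply]
  refine ⟨_, π, e, Module.finrank_pos, fun V hV => ?_, hπ⟩
  let W : Submodule (MonoidAlgebra ℂ G) M :=
    { V.comap e.toLinearMap with
      smul_mem' := fun x m hm => by
        induction x using MonoidAlgebra.induction_linear with
        | zero => simp
        | add x y hx hy => rw [add_smul]; exact (V.comap e.toLinearMap).add_mem hx hy
        | single g r =>
          have hs : MonoidAlgebra.single g r = r • MonoidAlgebra.of ℂ G g := by simp
          rw [hs, smul_assoc]
          refine (V.comap e.toLinearMap).smul_mem r ?_
          change e _ ∈ V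
          rw [← hπ]
          exact hV g _ hm }
  have hW (m : M) : m ∈ W ↔ e m ∈ V := Iff.rfl
  refine (eq_bot_or_eq_top W).imp (fun h => ?_) fun h => ?_
  · rw [Submodule.eq_bot_iff]
    intro v hv
    have : e.symm v ∈ W := by simpa [hW] using hv
    rw [h, Submodule.mem_bot] at this
    simpa using this
  · rw [Submodule.eq_top_iff']
    intro v
    have : e.symm v ∈ W := h ▸ Submodule.mem_top
    simpa [hW] using this

/-- A finite group `G` is non-cyclic iff for every `a ∈ G` there is a
nontrivial irreducible complex representation `π` of `G` such that `π(a)` has eigenvalue `1`. -/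
theorem not_isCyclic_iff_exists_irreducible_rep_fixed_vector
    {G : Type*} [Group G] [Finite G] :
    ¬ IsCyclic G ↔
    (∀ a : G, ∃ (n : ℕ) (π : G →* ((Fin n → ℂ) →ₗ[ℂ] (Fin n → ℂ))),
      0 < n ∧
      (∀ V : Submodule ℂ (Fin n → ℂ), (∀ g : G, ∀ v ∈ V, π g v ∈ V) → V = ⊥ ∨ V = ⊤) ∧
      (∃ g, π g ≠ 1) ∧
      (∃ v : Fin n → ℂ, v ≠ 0 ∧ π a v = v)) := by
  constructor
  · intro hG a
    have := Fintype.ofFinite G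
    have ha : Subgroup.zpowers a ≠ ⊤ := fun h => hG (isCyclic_iff_exists_zpowers_eq_top.mpr ⟨a, h⟩)
    obtain ⟨J, hJ, hIJ⟩ := Ideal.exists_le_maximal _ (MonoidAlgebra.span_sub_one_sum_ne_top a ha)
    have : IsSimpleModule (MonoidAlgebra ℂ G) (MonoidAlgebra ℂ G ⧸ J) :=
      isSimpleModule_iff_isCoatom.mpr hJ.out
    have : FiniteDimensional ℂ (MonoidAlgebra ℂ G) :=
      Module.Finite.of_basis (MonoidAlgebra.basis G ℂ)
    have : FiniteDimensional ℂ (MonoidAlgebra ℂ G ⧸ J) :=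
      Module.Finite.of_surjective (J.mkQ.restrictScalars ℂ) J.mkQ_surjective
    obtain ⟨n, π, e, hn, hirr, hπ⟩ :=
      MonoidAlgebra.exists_irreducible_rep_of_isSimpleModule (G := G) (M := MonoidAlgebra ℂ G ⧸ J)
    have h1 : J.mkQ 1 ≠ 0 := by
      rw [Submodule.mkQ_apply, Ne, Submodule.Quotient.mk_eq_zero]
      exact (Ideal.ne_top_iff_one J).mp hJ.ne_top
    have hg (g : G) : π g (e (J.mkQ 1)) = e (J.mkQ (MonoidAlgebra.of ℂ G g)) := by
      rw [hπ, ← map_smul, smul_eq_mul, mul_one]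
    refine ⟨n, π, hn, hirr, ?_, e (J.mkQ 1), by simpa using h1, ?_⟩
    · by_contra! htriv
      have hN : J.mkQ (∑ g : G, MonoidAlgebra.of ℂ G g) = 0 := by
        rw [Submodule.mkQ_apply, Submodule.Quotient.mk_eq_zero]
        exact hIJ (Ideal.subset_span (by simp))
      have hN' : e (J.mkQ (∑ g : G, MonoidAlgebra.of ℂ G g)) =
          (Fintype.card G : ℂ) • e (J.mkQ 1) := by
        rw [map_sum, map_sum]
        simp only [← hg, htriv, Module.End.one_apply, Finset.sum_const, Finset.card_univ,
          Nat.cast_smul_eq_nsmul]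
      rw [hN, map_zero, eq_comm, smul_eq_zero] at hN'
      refine hN'.elim (by simp) fun h => h1 (by simpa using h)
    · rw [hg]
      congr 1
      rw [← sub_eq_zero, ← map_sub, Submodule.mkQ_apply, Submodule.Quotient.mk_eq_zero]
      exact hIJ (Ideal.subset_span (by simp))
  · intro h hG
    obtain ⟨a, ha⟩ := hG.exists_zpow_surjective
    obtain ⟨n, π, -, hirr, ⟨g, hg⟩, v, hv, hav⟩ := h a
    have hfix (g : G) : π g v = v := by
      obtain ⟨k, rfl⟩ := mem_powers_iff_mem_zpowers.mpr (ha g)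
      simp only [map_pow]
      induction k with
      | zero => simp
      | succ k ih => rw [pow_succ, Module.End.mul_apply, hav, ih]
    rcases hirr (ℂ ∙ v) fun g w hw => by
      obtain ⟨r, rfl⟩ := Submodule.mem_span_singleton.mp hw
      rwa [map_smul, hfix] with hs | hs
    · exact hv (Submodule.span_singleton_eq_bot.mp hs)
    · refine hg (LinearMap.ext fun w => ?_)
      obtain ⟨r, rfl⟩ := Submodule.mem_span_singleton.mp (hs ▸ Submodule.mem_top : w ∈ ℂ ∙ v)
      rw [map_smul, hfix, Module.End.one_apply]
end

section
/- Let p be a prime, let ℤ_p be the ring of p-adic integers with its Haar probability measure, let a ∈ ℤ_p, let p' ∈ [1,∞), and let w : ℤ_p → (0,∞) be a bounded continuous function that is locally constant (every point has a neighborhood on which w is constant). Then the weighted translation operator T_{a,w} on L^{p'}(ℤ_p), defined by (T_{a,w} f)(x) = w(x)·f(x − a), is not hypercyclic. -/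
open MeasureTheory
open scoped ENNReal

/-- If a continuous seminorm `N` is expanded by `T` at most by a constant factor, and scaled exactly
by `T ^ m` with `0 < m`, then `T` has no dense orbit unless `N` vanishes. -/
theorem Seminorm.not_dense_orbit_of_pow_eq_mul {X : Type*} [NormedAddCommGroup X] [NormedSpace ℝ X]
    (T : X →L[ℝ] X) (N : Seminorm ℝ X) (hN : Continuous N) {C ρ : ℝ} (hC : 1 ≤ C) (hρ : 0 < ρ)
    {m : ℕ} (hm : 0 < m) (hle : ∀ g, N (T g) ≤ C * N g) (hpow : ∀ g, N ((T ^ m) g) = ρ * N g)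
    (hne : ∃ g, N g ≠ 0) (f : X) : ¬ Dense (Set.range fun n : ℕ => (T ^ n) f) := by
  intro hd
  have hleN : ∀ n g, N ((T ^ n) g) ≤ C ^ n * N g := by
    intro n g
    induction n with
    | zero => simp
    | succ k ih =>
      rw [pow_succ' T, mul_apply_eq_comp, pow_succ', mul_assoc]
      exact (hle _).trans (by gcongr)
  have hpowN : ∀ k g, N ((T ^ (m * k)) g) = ρ ^ k * N g := by
    intro k g
    induction k with
    | zero => simp
    | succ k ih =>
      rw [Nat.mul_succ, add_comm, pow_add, mul_apply_eq_comp, hpow, ih]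
      ring
  have hup : ∀ B : ℝ, ¬ ∀ n, N ((T ^ n) f) ≤ B := by
    intro B hB
    have hall : ∀ g, N g ≤ B := by
      intro g
      exact hd.induction (P := fun g => N g ≤ B) (by rintro _ ⟨n, rfl⟩; exact hB n)
        (isClosed_le hN continuous_const) g
    obtain ⟨g, hg⟩ := hne
    have hg' : 0 < N g := lt_of_le_of_ne (apply_nonneg N g) (Ne.symm hg)
    obtain ⟨k, hk⟩ := exists_nat_gt (B / N g)
    rw [div_lt_iff₀ hg'] at hk
    have := hall ((k : ℝ) • g)
    rw [map_smul_eq_mul] at this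
    simp at this
    linarith
  rcases le_total ρ 1 with h1 | h1
  · refine hup (C ^ m * N f) fun n => ?_
    rw [← Nat.mod_add_div n m, pow_add, mul_apply_eq_comp]
    calc _ ≤ C ^ (n % m) * N ((T ^ (m * (n / m))) f) := hleN _ _
      _ ≤ C ^ m * N f := by
        rw [hpowN]
        gcongr
        · exact (Nat.mod_lt n hm).le
        · exact mul_le_of_le_one_left (apply_nonneg N f) (pow_le_one₀ hρ.le h1)
  · have hlow : ∀ g, N f ≤ C ^ m * N g := by
      intro g
      refine hd.induction (P := fun g => N f ≤ C ^ m * N g) ?_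
        (isClosed_le continuous_const (continuous_const.mul hN)) g
      rintro _ ⟨n, rfl⟩
      have hr := Nat.mod_lt n hm
      have hn := Nat.mod_add_div n m
      have hsplit : m * (n / m + 1) = (m - n % m) + n := by
        rw [Nat.mul_succ]; omega
      calc N f ≤ ρ ^ (n / m + 1) * N f :=
            le_mul_of_one_le_left (apply_nonneg N f) (one_le_pow₀ h1)
        _ = N ((T ^ (m - n % m)) ((T ^ n) f)) := by
            rw [← hpowN, hsplit, pow_add, mul_apply_eq_comp]
        _ ≤ C ^ (m - n % m) * N ((T ^ n) f) := hleN _ _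
        _ ≤ C ^ m * N ((T ^ n) f) := by
            gcongr
            exact Nat.sub_le _ _
    have h0 : N f = 0 := le_antisymm (by simpa using hlow 0) (apply_nonneg N f)
    refine hup 0 fun n => ?_
    simpa [h0] using hleN n f

/-- A locally constant function on `ℤ_[p]` is periodic under some positive multiple of every
element. -/
theorem PadicInt.exists_periodic_of_isLocallyConstant {p : ℕ} [Fact p.Prime] {α : Type*}
    {w : ℤ_[p] → α} (hw : IsLocallyConstant w) (a : ℤ_[p]) :
    ∃ m : ℕ, 0 < m ∧ ∀ x, w (x - m * a) = w x := by
  obtain ⟨δ, hδ, h⟩ := lebesgue_number_lemma_of_metric (s := (Set.univ : Set ℤ_[p]))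
    (c := fun c : α => w ⁻¹' {c}) isCompact_univ (fun c => hw _)
    (fun x _ => Set.mem_iUnion.2 ⟨w x, rfl⟩)
  obtain ⟨k, hk⟩ := PadicInt.exists_pow_neg_lt p hδ
  refine ⟨p ^ k, pow_pos (Fact.out : p.Prime).pos k, fun x => ?_⟩
  obtain ⟨c, hc⟩ := h x trivial
  have hx : w x = c := hc (Metric.mem_ball_self hδ)
  rw [hx]
  refine hc ?_
  rw [Metric.mem_ball, dist_eq_norm, sub_sub_cancel_left, norm_neg, Nat.cast_pow, norm_mul,
    PadicInt.norm_p_pow]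
  exact (mul_le_of_le_one_right (by positivity) a.norm_le_one).trans_lt hk

/-- The iterates of a weighted translation operator. -/
theorem weightedTranslation_pow_ae_eq {G : Type*} [CommRing G] [MeasurableSpace G]
    [MeasurableAdd G] {μ : Measure G} [μ.IsAddLeftInvariant]
    {a : G} {w : G → ℝ} {q : ℝ≥0∞} [Fact (1 ≤ q)] {T : Lp ℝ q μ →L[ℝ] Lp ℝ q μ}
    (hT : ∀ f : Lp ℝ q μ, (T f : G → ℝ) =ᵐ[μ] fun x => w x * f (x - a))
    (n : ℕ) (f : Lp ℝ q μ) :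
    ((T ^ n) f : G → ℝ) =ᵐ[μ]
      fun x => (∏ i ∈ Finset.range n, w (x - i * a)) * f (x - n * a) := by
  induction n with
  | zero => simp
  | succ n ih =>
    rw [pow_succ' T, mul_apply_eq_comp]
    have hmp : MeasurePreserving (fun x : G => x - a) μ μ := by
      simpa only [sub_eq_add_neg] using measurePreserving_add_right μ (-a)
    filter_upwards [hT ((T ^ n) f), hmp.quasiMeasurePreserving.ae_eq_comp ih] with x h1 h2
    simp only [Function.comp_apply] at h2
    rw [h1, h2, Finset.prod_range_succ']
    have : ∀ i : ℕ, x - a - i * a = x - (i + 1 : ℕ) * a := by intro i; push_cast; ring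
    simp only [this]
    simp
    ring

/-- A weighted translation operator on `L^{p'}(ℤ_p)` with a locally constant
weight is not hypercyclic. -/
theorem padicInt_weighted_translation_not_hypercyclic_of_isLocallyConstant
    {p : ℕ} [Fact p.Prime]
    [MeasurableSpace ℤ_[p]] [BorelSpace ℤ_[p]]
    (μ : Measure ℤ_[p]) [μ.IsAddHaarMeasure] [IsProbabilityMeasure μ]
    (a : ℤ_[p])
    (w : ℤ_[p] → ℝ) (hw_cont : Continuous w) (hw_pos : ∀ x, 0 < w x)
    (hw_bdd : ∃ C : ℝ, ∀ x, w x ≤ C)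
    (hw_lc : IsLocallyConstant w)
    (p' : ℝ≥0∞) [Fact (1 ≤ p')] (hp'_top : p' ≠ ∞)
    (T : Lp ℝ p' μ →L[ℝ] Lp ℝ p' μ)
    (hT : ∀ f : Lp ℝ p' μ, (T f : ℤ_[p] → ℝ) =ᵐ[μ] fun x => w x * f (x - a)) :
    ¬ ∃ f : Lp ℝ p' μ, Dense (Set.range fun n : ℕ => ((T ^ n) f)) := by
  rintro ⟨f, hf⟩
  obtain ⟨C, hC⟩ := hw_bdd
  obtain ⟨m, hm, hper⟩ := PadicInt.exists_periodic_of_isLocallyConstant hw_lc a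
  set W : ℤ_[p] → ℝ := fun x => ∏ i ∈ Finset.range m, w (x - i * a) with hW
  have hWpos : ∀ x, 0 < W x := fun x => Finset.prod_pos fun i _ => hw_pos _
  have hWa : ∀ x, W (x - a) = W x := by
    intro x
    have h1 := Finset.prod_range_succ (fun i : ℕ => w (x - i * a)) m
    have h2 := Finset.prod_range_succ' (fun i : ℕ => w (x - i * a)) m
    have h3 : ∀ i : ℕ, x - a - i * a = x - (i + 1 : ℕ) * a := by intro i; push_cast; ring
    simp only [hW, h3]
    rw [h1, hper] at h2
    simp only [Nat.cast_zero, zero_mul, sub_zero] at h2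
    exact (mul_right_cancel₀ (hw_pos x).ne' h2).symm
  have hWlc : IsLocallyConstant W := by
    rw [IsLocallyConstant.iff_eventually_eq]
    intro x
    have : ∀ i ∈ Finset.range m, ∀ᶠ y in nhds x, w (y - i * a) = w (x - i * a) := fun i _ =>
      (hw_lc.comp_continuous (f := fun y : ℤ_[p] => y - i * a) (by fun_prop)).eventually_eq x
    filter_upwards [(Finset.eventually_all _).2 this] with y hy
    exact Finset.prod_congr rfl hy
  set ρ := W 0 with hρ
  set E : Set ℤ_[p] := W ⁻¹' {ρ} with hE
  have hEo : IsOpen E := hWlc _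
  have hEpos : 0 < μ E := hEo.measure_pos μ ⟨0, rfl⟩
  have hEm : MeasurableSet E := hEo.measurableSet
  have hmp : MeasurePreserving (fun x : ℤ_[p] => x - a) (μ.restrict E) (μ.restrict E) := by
    have h := (measurePreserving_add_right μ (-a)).restrict_preimage hEm
    simp only [← sub_eq_add_neg] at h
    have h' : (fun x => x - a) ⁻¹' E = E := by
      ext x
      simp [hE, hWa]
    rwa [h'] at h
  have hmpn : ∀ n : ℕ,
      MeasurePreserving (fun x : ℤ_[p] => x - n * a) (μ.restrict E) (μ.restrict E) := by
    intro n
    induction n with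
    | zero =>
      simp only [Nat.cast_zero, zero_mul, sub_zero]
      exact MeasurePreserving.id _
    | succ n ih =>
      convert hmp.comp ih using 2 with x
      simp only [Function.comp_apply]
      push_cast
      ring
  let R := LpToLpRestrictCLM ℤ_[p] ℝ ℝ μ p' E
  let N : Seminorm ℝ (Lp ℝ p' μ) := (normSeminorm ℝ _).comp R.toLinearMap
  have hNR : ∀ g, N g = ‖R g‖ := fun g => rfl
  have hR : ∀ g : Lp ℝ p' μ, (R g : ℤ_[p] → ℝ) =ᵐ[μ.restrict E] g :=
    fun g => LpToLpRestrictCLM_coeFn ℝ E g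
  have hcomp : ∀ (g : Lp ℝ p' μ) (n : ℕ), eLpNorm (fun x => g (x - n * a)) p' (μ.restrict E)
      = eLpNorm g p' (μ.restrict E) := fun g n =>
    eLpNorm_comp_measurePreserving (Lp.aestronglyMeasurable g).restrict (hmpn n)
  have hNe : ∀ g, N g = (eLpNorm g p' (μ.restrict E)).toReal := by
    intro g
    rw [hNR, Lp.norm_def, eLpNorm_congr_ae (hR g)]
  have hfin : ∀ g : Lp ℝ p' μ, eLpNorm g p' (μ.restrict E) ≠ ∞ := fun g =>
    ((Lp.memLp g).restrict E).eLpNorm_ne_top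
  have hC1 : ∀ x, w x ≤ max C 1 := fun x => (hC x).trans (le_max_left _ _)
  refine Seminorm.not_dense_orbit_of_pow_eq_mul T N (by exact R.continuous.norm)
    (le_max_right C 1) (hWpos 0) hm ?_ ?_ ?_ f hf
  · intro g
    have hC0 : 0 ≤ max C 1 := zero_le_one.trans (le_max_right _ _)
    have h1 : eLpNorm (T g) p' (μ.restrict E)
        ≤ ENNReal.ofReal (max C 1) * eLpNorm (fun x => g (x - (1 : ℕ) * a)) p' (μ.restrict E) := by
      refine eLpNorm_le_mul_eLpNorm_of_ae_le_mul ?_ p'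
      filter_upwards [ae_restrict_of_ae (hT g)] with x hx
      rw [hx, norm_mul, Real.norm_of_nonneg (hw_pos x).le, Nat.cast_one, one_mul]
      gcongr
      exact hC1 x
    rw [hcomp] at h1
    rw [hNe, hNe]
    have h2 := ENNReal.toReal_mono (ENNReal.mul_ne_top ENNReal.ofReal_ne_top (hfin g)) h1
    rwa [ENNReal.toReal_mul, ENNReal.toReal_ofReal hC0] at h2
  · intro g
    have h1 : ((T ^ m) g : ℤ_[p] → ℝ) =ᵐ[μ.restrict E] ρ • fun x => g (x - m * a) := by
      filter_upwards [ae_restrict_of_ae (weightedTranslation_pow_ae_eq hT m g),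
        ae_restrict_mem hEm] with x hx hxE
      rw [hx, Pi.smul_apply, smul_eq_mul]
      congr 1
    rw [hNe, hNe, eLpNorm_congr_ae h1, eLpNorm_const_smul, hcomp, ENNReal.toReal_mul,
      toReal_enorm, Real.norm_of_nonneg (hWpos 0).le]
  · refine ⟨Lp.const p' μ 1, ?_⟩
    have h1 : (Lp.const p' μ (1 : ℝ) : ℤ_[p] → ℝ) =ᵐ[μ.restrict E] fun _ => (1 : ℝ) :=
      ae_restrict_of_ae (Lp.coeFn_const p' μ (1 : ℝ))
    have h0 : p' ≠ 0 := (zero_lt_one.trans_le (Fact.out : 1 ≤ p')).ne'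
    have h2 : 0 < (μ E).toReal := ENNReal.toReal_pos hEpos.ne' (measure_ne_top μ E)
    rw [hNe, eLpNorm_congr_ae h1, eLpNorm_const' _ h0 hp'_top]
    simp only [enorm_one, one_mul, Measure.restrict_apply_univ, ← ENNReal.toReal_rpow]
    exact (Real.rpow_pos_of_pos h2 _).ne'
end

section
/- Let p be a prime, let ℚ_p be the field of p-adic numbers with the Haar measure on its additive group normalized so that ℤ_p has measure 1, let a ∈ ℚ_p, let p' ∈ [1,∞), and let w : ℚ_p → (0,∞) be a bounded continuous function that is locally constant (every point has a neighborhood on which w is constant). Then the weighted translation operator T_{a,w} on L^{p'}(ℚ_p), defined by (T_{a,w} f)(x) = w(x)·f(x − a), is not hypercyclic. -/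
open MeasureTheory
open scoped ENNReal

/-- An orbit of `T` is not dense if `T` scales some nonzero continuous seminorm `‖L ·‖`. -/
theorem not_dense_range_pow_of_norm_map_eq {E F : Type*} [NormedAddCommGroup E] [NormedSpace ℝ E]
    [NormedAddCommGroup F] [NormedSpace ℝ F] {T : E →L[ℝ] E} {L : E →L[ℝ] F} (hL : L ≠ 0)
    {ρ : ℝ} (hρ : 0 ≤ ρ) (hT : ∀ x, ‖L (T x)‖ = ρ * ‖L x‖) (x : E) :
    ¬ Dense (Set.range fun n : ℕ => (T ^ n) x) := by
  intro hd
  have hpow : ∀ n : ℕ, ‖L ((T ^ n) x)‖ = ρ ^ n * ‖L x‖ := by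
    intro n
    induction n with
    | zero => simp
    | succ n ih => rw [pow_succ', mul_apply_eq_comp, hT, ih, pow_succ']; ring
  obtain ⟨e, he⟩ : ∃ e, L e ≠ 0 := by
    by_contra! h
    exact hL (ContinuousLinearMap.ext h)
  have he' : 0 < ‖L e‖ := norm_pos_iff.2 he
  have hle : (∀ n : ℕ, ‖L ((T ^ n) x)‖ ≤ ‖L x‖) → False := by
    intro h
    have hall : ∀ y, ‖L y‖ ≤ ‖L x‖ := fun y =>
      hd.induction (P := fun y => ‖L y‖ ≤ ‖L x‖) (by rintro _ ⟨n, rfl⟩; exact h n)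
        (isClosed_le (by fun_prop) continuous_const) y
    have := hall (((‖L x‖ + 1) / ‖L e‖) • e)
    rw [map_smul, norm_smul, Real.norm_of_nonneg (by positivity), div_mul_cancel₀ _ he'.ne'] at this
    linarith
  rcases le_total ρ 1 with h1 | h1
  · exact hle fun n => by
      rw [hpow]
      exact mul_le_of_le_one_left (norm_nonneg _) (pow_le_one₀ hρ h1)
  · have hall : ∀ y, ‖L x‖ ≤ ‖L y‖ := fun y =>
      hd.induction (P := fun y => ‖L x‖ ≤ ‖L y‖)
        (by
          rintro _ ⟨n, rfl⟩
          rw [hpow]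
          exact le_mul_of_one_le_left (norm_nonneg _) (one_le_pow₀ h1))
        (isClosed_le continuous_const (by fun_prop)) y
    have h0 : ‖L x‖ = 0 := le_antisymm (by simpa using hall 0) (norm_nonneg _)
    exact hle fun n => by rw [hpow, h0, mul_zero]

theorem IsLocallyConstant.exists_forall_dist_lt_eq {X Y : Type*} [PseudoMetricSpace X]
    {f : X → Y} (hf : IsLocallyConstant f) {K : Set X} (hK : IsCompact K) :
    ∃ δ > 0, ∀ x ∈ K, ∀ y, dist y x < δ → f y = f x := by
  obtain ⟨δ, hδ, h⟩ := lebesgue_number_lemma_of_metric hK (c := fun y : Y => f ⁻¹' {y})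
    (fun y => hf _) (fun x _ => Set.mem_iUnion.2 ⟨f x, rfl⟩)
  refine ⟨δ, hδ, fun x hx y hy => ?_⟩
  obtain ⟨c, hc⟩ := h x hx
  exact (hc (Metric.mem_ball.2 hy)).trans (hc (Metric.mem_ball_self hδ)).symm

/-- A weighted Birkhoff sum whose coboundary is `N * g` minus the Birkhoff sum of `g`. -/
theorem sum_sub_sum_translate_eq {G : Type*} [AddCommGroup G] (g : G → ℝ) (a x : G) (N : ℕ) :
    ∑ k ∈ Finset.range N, (N - 1 - k : ℝ) * g (x - k • a)
      - ∑ k ∈ Finset.range N, (N - 1 - k : ℝ) * g (x - a - k • a)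
      = N * g x - ∑ k ∈ Finset.range N, g (x - k • a) := by
  have hshift : ∀ k : ℕ, x - a - k • a = x - (k + 1) • a := fun k => by
    rw [succ_nsmul]; abel
  have h1 := Finset.sum_range_succ' (fun k : ℕ => (N - k : ℝ) * g (x - k • a)) N
  have h2 := Finset.sum_range_succ (fun k : ℕ => (N - k : ℝ) * g (x - k • a)) N
  have h3 : ∑ k ∈ Finset.range N, (N - k : ℝ) * g (x - k • a)
      = ∑ k ∈ Finset.range N, (N - 1 - k : ℝ) * g (x - k • a)
        + ∑ k ∈ Finset.range N, g (x - k • a) := by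
    rw [← Finset.sum_add_distrib]
    exact Finset.sum_congr rfl fun k _ => by ring
  have h4 : ∑ k ∈ Finset.range N, (N - 1 - k : ℝ) * g (x - a - k • a)
      = ∑ k ∈ Finset.range N, (N - (k + 1 : ℕ) : ℝ) * g (x - (k + 1) • a) :=
    Finset.sum_congr rfl fun k _ => by rw [hshift]; push_cast; ring
  simp only [sub_self, zero_mul, zero_smul, sub_zero, Nat.cast_zero, add_zero] at h1 h2
  rw [h4]
  linarith

/-- A weighted translation operator on `L^q` with weight `w` is not hypercyclic as soon as `w` is
cohomologous to a constant `ρ` on a translation invariant set of finite positive measure. -/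
theorem not_dense_range_pow_weightedTranslation {G : Type*} [AddCommGroup G] [MeasurableSpace G]
    [MeasurableAdd G] {μ : Measure G} [μ.IsAddRightInvariant] {q : ℝ≥0∞} [Fact (1 ≤ q)]
    {a : G} {w v : G → ℝ} {ρ : ℝ} (hρ : 0 ≤ ρ) (hv : MemLp v ∞ μ)
    {s : Set G} (hs : MeasurableSet s) (hs₀ : μ s ≠ 0) (hs_top : μ s ≠ ∞) (hvs : ∀ x ∈ s, v x ≠ 0)
    (hvw : ∀ x, v x * w x = ρ * v (x - a))
    {T : Lp ℝ q μ →L[ℝ] Lp ℝ q μ}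
    (hT : ∀ f : Lp ℝ q μ, (T f : G → ℝ) =ᵐ[μ] fun x => w x * f (x - a)) (f : Lp ℝ q μ) :
    ¬ Dense (Set.range fun n : ℕ => (T ^ n) f) := by
  let L : Lp ℝ q μ →L[ℝ] Lp ℝ q μ :=
    (ContinuousLinearMap.mul ℝ ℝ).holderL μ ∞ q q (hv.toLp v)
  have hL : ∀ h : Lp ℝ q μ, (L h : G → ℝ) =ᵐ[μ] fun x => v x * h x := by
    intro h
    filter_upwards [(ContinuousLinearMap.mul ℝ ℝ).coeFn_holder (r := q) (hv.toLp v) h,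
      hv.coeFn_toLp] with x hx hx'
    have : (L h : G → ℝ) x = _ := hx
    rw [this, hx', ContinuousLinearMap.mul_apply']
  refine not_dense_range_pow_of_norm_map_eq (L := L) ?_ hρ ?_ f
  · intro h0
    have h1 := hL (indicatorConstLp q hs hs_top 1)
    rw [h0, zero_apply] at h1
    have h2 : ∀ᵐ x ∂μ, x ∉ s := by
      filter_upwards [h1, Lp.coeFn_zero ℝ q μ,
        indicatorConstLp_coeFn (p := q) (hs := hs) (hμs := hs_top) (c := (1 : ℝ))]
        with x hx hx' hx'' hxs
      rw [hx', hx'', Set.indicator_of_mem hxs, mul_one] at hx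
      exact hvs x hxs hx.symm
    exact hs₀ (by simpa [ae_iff] using h2)
  · intro h
    have hmp : MeasurePreserving (fun x => x - a) μ μ := measurePreserving_sub_right μ a
    have hcongr : (L (T h) : G → ℝ) =ᵐ[μ] ρ • ((L h : G → ℝ) ∘ fun x => x - a) := by
      filter_upwards [hL (T h), hT h, hmp.quasiMeasurePreserving.ae (hL h)] with x h1 h2 h3
      simp only [Pi.smul_apply, Function.comp_apply, smul_eq_mul]
      rw [h1, h2, h3, ← mul_assoc, hvw, mul_assoc]
    rw [Lp.norm_def, Lp.norm_def, eLpNorm_congr_ae hcongr, eLpNorm_const_smul,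
      eLpNorm_comp_measurePreserving (Lp.aestronglyMeasurable _) hmp, ENNReal.toReal_mul,
      toReal_enorm, Real.norm_of_nonneg hρ]

/-- A weighted translation operator on `L^{p'}(ℚ_p)` (Haar measure normalized
so that `μ(ℤ_p) = 1`) with a locally constant weight is not hypercyclic. -/
theorem padic_weighted_translation_not_hypercyclic_of_isLocallyConstant
    {p : ℕ} [Fact p.Prime]
    [MeasurableSpace ℚ_[p]] [BorelSpace ℚ_[p]]
    (μ : Measure ℚ_[p]) [μ.IsAddHaarMeasure]
    (hμ : μ {x : ℚ_[p] | ‖x‖ ≤ 1} = 1)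
    (a : ℚ_[p])
    (w : ℚ_[p] → ℝ) (hw_cont : Continuous w) (hw_pos : ∀ x, 0 < w x)
    (hw_bdd : ∃ C : ℝ, ∀ x, w x ≤ C)
    (hw_lc : IsLocallyConstant w)
    (p' : ℝ≥0∞) [Fact (1 ≤ p')] (hp'_top : p' ≠ ∞)
    (T : Lp ℝ p' μ →L[ℝ] Lp ℝ p' μ)
    (hT : ∀ f : Lp ℝ p' μ, (T f : ℚ_[p] → ℝ) =ᵐ[μ] fun x => w x * f (x - a)) :
    ¬ ∃ f : Lp ℝ p' μ, Dense (Set.range fun n : ℕ => ((T ^ n) f)) := by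
  rintro ⟨f, hf⟩
  obtain ⟨δ, hδ, hconst⟩ :=
    hw_lc.exists_forall_dist_lt_eq (isCompact_closedBall (0 : ℚ_[p]) ‖a‖)
  have hmult : ∀ i : ℤ, ‖i • a‖ ≤ ‖a‖ := fun i => by
    rw [zsmul_eq_mul, norm_mul]
    exact mul_le_of_le_one_left (norm_nonneg _) (Padic.norm_int_le_one i)
  -- the orbit of a small ball under translation by multiples of `a`
  set s : Set ℚ_[p] := ⋃ i : ℤ, Metric.ball (i • a) δ with hs
  have hs_open : IsOpen s := isOpen_iUnion fun _ => Metric.isOpen_ball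
  have hs_inv : ∀ (x : ℚ_[p]) (i : ℤ), x ∈ s → x - i • a ∈ s := by
    intro x i hx
    obtain ⟨j, hj⟩ := Set.mem_iUnion.1 hx
    refine Set.mem_iUnion.2 ⟨j - i, ?_⟩
    rw [Metric.mem_ball, dist_eq_norm] at hj ⊢
    rwa [sub_smul, sub_sub_sub_cancel_right]
  have hs_inv_iff : ∀ x, x - a ∈ s ↔ x ∈ s := fun x =>
    ⟨fun h => by simpa using hs_inv _ (-1) h, fun h => by simpa using hs_inv _ 1 h⟩
  have hw_eq : ∀ (i : ℤ) (z : ℚ_[p]), ‖z‖ < δ → w (i • a + z) = w (i • a) := fun i z hz =>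
    hconst _ (by simpa using hmult i) _ (by simpa [dist_eq_norm] using hz)
  have hs_sub : s ⊆ Metric.closedBall 0 (‖a‖ + δ) := by
    refine Set.iUnion_subset fun i x hx => ?_
    rw [Metric.mem_ball, dist_eq_norm] at hx
    rw [mem_closedBall_zero_iff]
    calc ‖x‖ = ‖i • a + (x - i • a)‖ := by rw [add_sub_cancel]
      _ ≤ ‖i • a‖ + ‖x - i • a‖ := norm_add_le _ _
      _ ≤ ‖a‖ + δ := add_le_add (hmult i) hx.le
  obtain ⟨N, hN, hNa⟩ : ∃ N : ℕ, 0 < N ∧ ‖N • a‖ < δ := by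
    have ht : Filter.Tendsto (fun n : ℕ => (p : ℚ_[p]) ^ n * a) Filter.atTop (nhds (0 * a)) :=
      (tendsto_pow_atTop_nhds_zero_of_norm_lt_one Padic.norm_p_lt_one).mul_const a
    rw [zero_mul] at ht
    obtain ⟨n, hn⟩ := (ht.norm.eventually_lt_const (by simpa using hδ)).exists
    exact ⟨p ^ n, pow_pos (Fact.out : p.Prime).pos n, by simpa using hn⟩
  have hN' : (N : ℝ) ≠ 0 := by positivity
  set g : ℚ_[p] → ℝ := fun x => Real.log (w x) with hg
  have hg_cont : Continuous g := hw_cont.log fun x => (hw_pos x).ne'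
  have hg_eq : ∀ (i : ℤ) (z : ℚ_[p]), ‖z‖ < δ → g (i • a + z) = g (i • a) := fun i z hz => by
    simp only [hg, hw_eq i z hz]
  have hper : ∀ x ∈ s, g (x - N • a) = g x := by
    intro x hx
    obtain ⟨i, hi⟩ := Set.mem_iUnion.1 hx
    rw [Metric.mem_ball, dist_eq_norm] at hi
    have h1 := hg_eq i (x - i • a) hi
    have h2 := hg_eq i (x - i • a + -(N • a))
      ((IsUltrametricDist.norm_add_le_max _ _).trans_lt (max_lt hi (by rwa [norm_neg])))
    rw [add_sub_cancel] at h1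
    rw [h1, ← h2]
    congr 1
    abel
  set S : ℚ_[p] → ℝ := fun x => ∑ k ∈ Finset.range N, g (x - k • a) with hS
  have hS_const : ∀ x ∈ s, S x = S 0 := by
    have hstep : ∀ x ∈ s, S (x - a) = S x := by
      intro x hx
      have h1 := Finset.sum_range_succ' (fun k : ℕ => g (x - k • a)) N
      have h2 := Finset.sum_range_succ (fun k : ℕ => g (x - k • a)) N
      have h3 : S (x - a) = ∑ k ∈ Finset.range N, g (x - (k + 1) • a) :=
        Finset.sum_congr rfl fun k _ => by rw [succ_nsmul]; congr 1; abel
      simp only [zero_smul, sub_zero, hper x hx] at h1 h2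
      rw [h3]
      linarith
    have hsmul : ∀ i : ℤ, S (i • a) = S 0 := by
      have hmem : ∀ i : ℤ, i • a ∈ s := fun i =>
        Set.mem_iUnion.2 ⟨i, Metric.mem_ball_self hδ⟩
      intro i
      induction i with
      | zero => simp
      | succ i ih =>
        rw [← ih, ← hstep _ (hmem _)]
        congr 1
        rw [add_smul, one_smul, add_sub_cancel_right]
      | pred i ih => rw [sub_smul, one_smul, hstep _ (hmem _), ih]
    intro x hx
    obtain ⟨i, hi⟩ := Set.mem_iUnion.1 hx
    rw [Metric.mem_ball, dist_eq_norm] at hi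
    rw [← hsmul i]
    refine Finset.sum_congr rfl fun k _ => ?_
    have h1 := hg_eq (i - k) (x - i • a) hi
    rw [sub_smul, natCast_zsmul] at h1
    rw [← h1]
    congr 1
    abel
  set u : ℚ_[p] → ℝ := fun x =>
    (∑ k ∈ Finset.range N, (N - 1 - k : ℝ) * g (x - k • a)) / N with hu
  have hu_cont : Continuous u := by fun_prop
  have hu_eq : ∀ x ∈ s, u x - u (x - a) = g x - S 0 / N := by
    intro x hx
    have := sum_sub_sum_translate_eq g a x N
    rw [← hS_const x hx]
    simp only [hu, hS]
    rw [← sub_div, this, sub_div, mul_div_cancel_left₀ _ hN']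
  set v : ℚ_[p] → ℝ := s.indicator fun x => Real.exp (-u x) with hv
  obtain ⟨C, hC⟩ := (isCompact_closedBall (0 : ℚ_[p]) (‖a‖ + δ)).exists_bound_of_continuousOn
    (f := fun x => Real.exp (-u x)) (by fun_prop)
  have hv_mem : MemLp v ∞ μ := by
    refine memLp_top_of_bound ((Continuous.aestronglyMeasurable (by fun_prop)).indicator
      hs_open.measurableSet) (max C 0) (.of_forall fun x => ?_)
    by_cases hx : x ∈ s
    · rw [hv, Set.indicator_of_mem hx]
      exact (hC x (hs_sub hx)).trans (le_max_left _ _)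
    · rw [hv, Set.indicator_of_notMem hx, norm_zero]
      exact le_max_right _ _
  refine not_dense_range_pow_weightedTranslation (v := v) (s := s) (Real.exp_nonneg (S 0 / N))
    hv_mem hs_open.measurableSet (hs_open.measure_ne_zero μ ?_) ?_ ?_ ?_ hT f hf
  · exact ⟨0, Set.mem_iUnion.2 ⟨0, by simpa using hδ⟩⟩
  · exact ((measure_mono hs_sub).trans_lt measure_closedBall_lt_top).ne
  · intro x hx
    rw [hv, Set.indicator_of_mem hx]
    exact Real.exp_ne_zero _
  · intro x
    by_cases hx : x ∈ s
    · rw [hv, Set.indicator_of_mem hx, Set.indicator_of_mem ((hs_inv_iff x).2 hx),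
        ← Real.exp_log (hw_pos x), ← Real.exp_add, ← Real.exp_add]
      congr 1
      have := hu_eq x hx
      simp only [hg] at this
      linarith
    · rw [hv, Set.indicator_of_notMem hx, Set.indicator_of_notMem (mt (hs_inv_iff x).1 hx),
        zero_mul, mul_zero]
end

section
/- Let p be a prime, let ℚ_p be the field of p-adic numbers with the Haar measure on its additive group normalized so that ℤ_p has measure 1, let a ∈ ℚ_p with a ≠ 0, let w : ℚ_p → (0,∞) be a bounded continuous function such that x ↦ ln(w(x)) is integrable on ℚ_p, and let p' ∈ [1,∞). If the weighted translation operator T_{a,w} on L^{p'}(ℚ_p), defined by (T_{a,w} f)(x) = w(x)·f(x − a), is hypercyclic, then ∫_{ℚ_p} ln(w(x)) dx = 0 and w is not locally constant. -/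
open MeasureTheory
open scoped ENNReal

section Sequence

variable {u : ℕ → ℝ} {N : ℕ}

lemma bddAbove_range_of_add_le (hu : ∀ n, 0 ≤ u n) (hN : 0 < N) (h : ∀ n, u (n + N) ≤ u n) :
    BddAbove (Set.range u) := by
  have key : ∀ q r, u (r + N * q) ≤ u r := by
    intro q r
    induction q with
    | zero => simp
    | succ q ih => rw [mul_add_one, ← add_assoc]; exact (h _).trans ih
  refine ⟨∑ r ∈ Finset.range N, u r, ?_⟩
  rintro _ ⟨n, rfl⟩
  calc u n = u (n % N + N * (n / N)) := by rw [Nat.mod_add_div]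
    _ ≤ u (n % N) := key _ _
    _ ≤ _ := Finset.single_le_sum (fun i _ => hu i) (Finset.mem_range.2 (Nat.mod_lt n hN))

lemma exists_pos_le_of_le_add (hu : ∀ n, 0 < u n) (hN : 0 < N) (h : ∀ n, u n ≤ u (n + N)) :
    ∃ m > 0, ∀ n, m ≤ u n := by
  obtain ⟨C, hC⟩ := bddAbove_range_of_add_le (u := fun n => (u n)⁻¹)
    (fun n => (inv_pos.2 (hu n)).le) hN (fun n => inv_anti₀ (hu n) (h n))
  have hC' : ∀ n, (u n)⁻¹ ≤ C := fun n => hC ⟨n, rfl⟩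
  have hC0 : 0 < C := (inv_pos.2 (hu 0)).trans_le (hC' 0)
  exact ⟨C⁻¹, inv_pos.2 hC0, fun n => inv_le_of_inv_le₀ (hu n) (hC' n)⟩

lemma bddAbove_range_of_eventually_zero {r : ℕ} (h : ∀ n, r ≤ n → u n = 0) :
    BddAbove (Set.range u) := by
  have hfin : (Set.range u).Finite := by
    refine ((Set.finite_Iio r).image u |>.insert 0).subset ?_
    rintro _ ⟨n, rfl⟩
    rcases lt_or_ge n r with hn | hn
    · exact Or.inr ⟨n, hn, rfl⟩
    · exact Or.inl (h n hn)
  exact hfin.bddAbove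

end Sequence

section DenseOrbit

variable {E F : Type*} [NormedAddCommGroup E] [NormedSpace ℝ E] [NormedAddCommGroup F]
  [NormedSpace ℝ F]

lemma exists_norm_map_gt_of_dense {g : ℕ → E} (hg : Dense (Set.range g)) (R : E →L[ℝ] F) {e : E}
    (he : R e ≠ 0) (M : ℝ) : ∃ n, M < ‖R (g n)‖ := by
  have hopen : IsOpen {x : E | M < ‖R x‖} := isOpen_lt continuous_const (by fun_prop)
  have hne : {x : E | M < ‖R x‖}.Nonempty := by
    refine ⟨((|M| + 1) / ‖R e‖) • e, ?_⟩
    have h0 : 0 < ‖R e‖ := norm_pos_iff.2 he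
    simp only [Set.mem_ofPred_eq, map_smul, norm_smul, Real.norm_eq_abs]
    rw [abs_of_pos (by positivity), div_mul_cancel₀ _ h0.ne']
    linarith [le_abs_self M]
  obtain ⟨_, hx, n, rfl⟩ := hg.inter_open_nonempty _ hopen hne
  exact ⟨n, hx⟩

lemma exists_norm_map_lt_of_dense {g : ℕ → E} (hg : Dense (Set.range g)) (R : E →L[ℝ] F) {m : ℝ}
    (hm : 0 < m) : ∃ n, ‖R (g n)‖ < m := by
  have hopen : IsOpen {x : E | ‖R x‖ < m} := isOpen_lt (by fun_prop) continuous_const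
  obtain ⟨_, hx, n, rfl⟩ := hg.inter_open_nonempty _ hopen ⟨0, by simpa using hm⟩
  exact ⟨n, hx⟩

end DenseOrbit

section RestrictLp

variable {X : Type*} [MeasurableSpace X] {μ : Measure X} {q : ℝ≥0∞} [Fact (1 ≤ q)] {C : Set X}

lemma norm_LpToLpRestrictCLM (f : Lp ℝ q μ) :
    ‖LpToLpRestrictCLM X ℝ ℝ μ q C f‖ = (eLpNorm f q (μ.restrict C)).toReal := by
  rw [Lp.norm_def, eLpNorm_congr_ae (LpToLpRestrictCLM_coeFn ℝ C f)]

lemma exists_restrict_ne_zero (hCm : MeasurableSet C) (hC0 : μ C ≠ 0) (hCtop : μ C ≠ ∞) :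
    ∃ e : Lp ℝ q μ, LpToLpRestrictCLM X ℝ ℝ μ q C e ≠ 0 := by
  refine ⟨indicatorConstLp q hCm hCtop 1, fun h => hC0 ?_⟩
  have h1 := LpToLpRestrictCLM_coeFn ℝ C (indicatorConstLp q hCm hCtop (1 : ℝ))
  rw [h] at h1
  have h2 : ∀ᵐ x ∂μ.restrict C, False := by
    filter_upwards [h1, Lp.coeFn_zero ℝ q (μ.restrict C), ae_restrict_mem hCm,
      ae_restrict_of_ae (indicatorConstLp_coeFn (p := q) (hs := hCm) (hμs := hCtop) (c := (1 : ℝ)))]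
      with x h1 h2 hx h3
    rw [h2, h3, Set.indicator_of_mem hx] at h1
    simp at h1
  simpa using h2

end RestrictLp

lemma sub_nsmul_mem_iff {G : Type*} [AddCommGroup G] {a : G} {C : Set G}
    (hC : ∀ x, x - a ∈ C ↔ x ∈ C) (n : ℕ) (x : G) :
    x - n • a ∈ C ↔ x ∈ C := by
  induction n with
  | zero => simp
  | succ n ih => rw [succ_nsmul, ← sub_sub, hC, ih]

section WeightedTranslation

variable {G : Type*} [AddCommGroup G] [MeasurableSpace G] [MeasurableAdd G]
  {μ : Measure G} [μ.IsAddRightInvariant] {a : G} {w : G → ℝ} {q : ℝ≥0∞} [Fact (1 ≤ q)]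
  {T : Lp ℝ q μ →L[ℝ] Lp ℝ q μ} {C : Set G}

lemma weightedTranslation_pow_apply
    (hT : ∀ f : Lp ℝ q μ, (T f : G → ℝ) =ᵐ[μ] fun x => w x * f (x - a)) (n : ℕ) (f : Lp ℝ q μ) :
    ((T ^ n) f : G → ℝ) =ᵐ[μ] fun x => (∏ j ∈ Finset.range n, w (x - j • a)) * f (x - n • a) := by
  induction n with
  | zero => simp
  | succ n ih =>
    have h := (measurePreserving_sub_right μ a).quasiMeasurePreserving.ae ih
    rw [pow_succ', mul_apply_eq_comp]
    filter_upwards [hT ((T ^ n) f), h] with x hx hx'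
    rw [hx, hx', Finset.prod_range_succ']
    simp only [succ_nsmul', sub_sub, zero_smul, sub_zero]
    ring

lemma measurePreserving_sub_nsmul_restrict (hCm : MeasurableSet C)
    (hC : ∀ x, x - a ∈ C ↔ x ∈ C) (n : ℕ) :
    MeasurePreserving (fun x => x - n • a) (μ.restrict C) (μ.restrict C) := by
  have h := (measurePreserving_sub_right μ (n • a)).restrict_preimage hCm
  rwa [show (fun x => x - n • a) ⁻¹' C = C from Set.ext fun x => sub_nsmul_mem_iff hC n x] at h

lemma norm_restrict_translate (hCm : MeasurableSet C) (hC : ∀ x, x - a ∈ C ↔ x ∈ C) (n : ℕ)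
    (f : Lp ℝ q μ) :
    ‖LpToLpRestrictCLM G ℝ ℝ μ q C f‖
      = (eLpNorm (fun x => f (x - n • a)) q (μ.restrict C)).toReal := by
  rw [norm_LpToLpRestrictCLM, ← eLpNorm_comp_measurePreserving
    (Lp.aestronglyMeasurable f).restrict (measurePreserving_sub_nsmul_restrict hCm hC n)]
  rfl

lemma norm_restrict_pow_le
    (hT : ∀ f : Lp ℝ q μ, (T f : G → ℝ) =ᵐ[μ] fun x => w x * f (x - a)) (hw : ∀ x, 0 < w x)
    (hCm : MeasurableSet C) (hC : ∀ x, x - a ∈ C ↔ x ∈ C) {N : ℕ}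
    (h : ∀ x ∈ C, ∏ j ∈ Finset.range N, w (x - j • a) ≤ 1) (f : Lp ℝ q μ) :
    ‖LpToLpRestrictCLM G ℝ ℝ μ q C ((T ^ N) f)‖ ≤ ‖LpToLpRestrictCLM G ℝ ℝ μ q C f‖ := by
  rw [norm_restrict_translate hCm hC N f, norm_LpToLpRestrictCLM]
  refine ENNReal.toReal_mono
    (((Lp.memLp f).restrict C).comp_measurePreserving
      (measurePreserving_sub_nsmul_restrict hCm hC N)).eLpNorm_ne_top (eLpNorm_mono_ae ?_)
  filter_upwards [ae_restrict_mem hCm, ae_restrict_of_ae (weightedTranslation_pow_apply hT N f)]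
    with x hxC hx
  have hpos : 0 < ∏ j ∈ Finset.range N, w (x - j • a) := Finset.prod_pos fun j _ => hw _
  rw [hx, norm_mul, Real.norm_of_nonneg hpos.le]
  exact mul_le_of_le_one_left (norm_nonneg _) (h x hxC)

lemma le_norm_restrict_pow
    (hT : ∀ f : Lp ℝ q μ, (T f : G → ℝ) =ᵐ[μ] fun x => w x * f (x - a)) (hw : ∀ x, 0 < w x)
    (hCm : MeasurableSet C) (hC : ∀ x, x - a ∈ C ↔ x ∈ C) {N : ℕ}
    (h : ∀ x ∈ C, 1 ≤ ∏ j ∈ Finset.range N, w (x - j • a)) (f : Lp ℝ q μ) :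
    ‖LpToLpRestrictCLM G ℝ ℝ μ q C f‖ ≤ ‖LpToLpRestrictCLM G ℝ ℝ μ q C ((T ^ N) f)‖ := by
  rw [norm_restrict_translate hCm hC N f, norm_LpToLpRestrictCLM]
  refine ENNReal.toReal_mono ((Lp.memLp ((T ^ N) f)).restrict C).eLpNorm_ne_top
    (eLpNorm_mono_ae ?_)
  filter_upwards [ae_restrict_mem hCm, ae_restrict_of_ae (weightedTranslation_pow_apply hT N f)]
    with x hxC hx
  have hpos : 0 < ∏ j ∈ Finset.range N, w (x - j • a) := Finset.prod_pos fun j _ => hw _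
  rw [hx, norm_mul, Real.norm_of_nonneg hpos.le]
  exact le_mul_of_one_le_left (norm_nonneg _) (h x hxC)

lemma restrict_map_eq_zero
    (hT : ∀ f : Lp ℝ q μ, (T f : G → ℝ) =ᵐ[μ] fun x => w x * f (x - a))
    (hCm : MeasurableSet C) (hC : ∀ x, x - a ∈ C ↔ x ∈ C) {f : Lp ℝ q μ}
    (hf : LpToLpRestrictCLM G ℝ ℝ μ q C f = 0) : LpToLpRestrictCLM G ℝ ℝ μ q C (T f) = 0 := by
  have hf' : (f : G → ℝ) =ᵐ[μ.restrict C] 0 := by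
    have := LpToLpRestrictCLM_coeFn ℝ C f
    rw [hf] at this
    exact this.symm.trans (Lp.coeFn_zero _ _ _)
  have hs := (measurePreserving_sub_nsmul_restrict (μ := μ) hCm hC 1).quasiMeasurePreserving.ae hf'
  rw [Lp.eq_zero_iff_ae_eq_zero]
  refine (LpToLpRestrictCLM_coeFn ℝ C (T f)).trans ?_
  filter_upwards [hs, ae_restrict_of_ae (hT f)] with x hx hx'
  rw [one_smul] at hx
  simp [hx', hx]

/-- If a weighted translation is hypercyclic, then on no invariant set of positive finite measure
do its cocycle products stay on one side of `1`. -/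
theorem exists_prod_gt_and_lt_of_dense_orbit
    (hT : ∀ f : Lp ℝ q μ, (T f : G → ℝ) =ᵐ[μ] fun x => w x * f (x - a)) (hw : ∀ x, 0 < w x)
    (hhyp : ∃ f : Lp ℝ q μ, Dense (Set.range fun n : ℕ => (T ^ n) f))
    (hCm : MeasurableSet C) (hC : ∀ x, x - a ∈ C ↔ x ∈ C) (hC0 : μ C ≠ 0) (hCtop : μ C ≠ ∞)
    {N : ℕ} (hN : 0 < N) :
    (∃ x ∈ C, 1 < ∏ j ∈ Finset.range N, w (x - j • a)) ∧
      ∃ x ∈ C, ∏ j ∈ Finset.range N, w (x - j • a) < 1 := by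
  obtain ⟨f, hf⟩ := hhyp
  obtain ⟨e, he⟩ := exists_restrict_ne_zero (q := q) hCm hC0 hCtop
  set R := LpToLpRestrictCLM G ℝ ℝ μ q C with hR
  have hunbdd : ¬ BddAbove (Set.range fun n => ‖R ((T ^ n) f)‖) := by
    rintro ⟨M, hM⟩
    obtain ⟨n, hn⟩ := exists_norm_map_gt_of_dense hf R he M
    exact hn.not_ge (hM ⟨n, rfl⟩)
  have hadd : ∀ m n, (T ^ (n + m)) f = (T ^ m) ((T ^ n) f) := fun m n => by
    rw [add_comm, pow_add, mul_apply_eq_comp]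
  constructor <;> by_contra! h
  · refine hunbdd (bddAbove_range_of_add_le (fun n => norm_nonneg _) hN fun n => ?_)
    rw [hadd]
    exact norm_restrict_pow_le hT hw hCm hC h _
  · by_cases hz : ∃ r, R ((T ^ r) f) = 0
    · obtain ⟨r, hr⟩ := hz
      refine hunbdd (bddAbove_range_of_eventually_zero (r := r) fun n hn => ?_)
      rw [norm_eq_zero]
      induction n, hn using Nat.le_induction with
      | base => exact hr
      | succ n _ ih =>
        rw [hadd, pow_one]
        exact restrict_map_eq_zero hT hCm hC ih
    · push Not at hz
      obtain ⟨m, hm, hle⟩ := exists_pos_le_of_le_add (u := fun n => ‖R ((T ^ n) f)‖)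
        (fun n => norm_pos_iff.2 (hz n)) hN fun n => by
          rw [hadd]
          exact le_norm_restrict_pow hT hw hCm hC h _
      obtain ⟨n, hn⟩ := exists_norm_map_lt_of_dense hf R hm
      exact hn.not_ge (hle n)

lemma setIntegral_sum_sub_nsmul (hCm : MeasurableSet C) (hC : ∀ x, x - a ∈ C ↔ x ∈ C)
    {φ : G → ℝ} (hφ : IntegrableOn φ C μ) (N : ℕ) :
    ∫ x in C, ∑ j ∈ Finset.range N, φ (x - j • a) ∂μ = N * ∫ x in C, φ x ∂μ := by
  have hmp := measurePreserving_sub_nsmul_restrict (μ := μ) hCm hC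
  rw [integral_finsetSum _ fun j _ => by exact (hmp j).integrable_comp_of_integrable hφ]
  have : ∀ j : ℕ, ∫ x in C, φ (x - j • a) ∂μ = ∫ x in C, φ x ∂μ := fun j =>
    (hmp j).integral_comp (measurableEmbedding_subRight (j • a)) φ
  simp [this]

end WeightedTranslation

section Padic

variable {p : ℕ} [Fact p.Prime]

lemma Padic.exists_nsmul_norm_sub_le {a y : ℚ_[p]} (hy : ‖y‖ ≤ ‖a‖) (k : ℕ) :
    ∃ i < p ^ k, ‖y - i • a‖ ≤ ‖p ^ k • a‖ := by
  rcases eq_or_ne a 0 with rfl | ha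
  · exact ⟨0, pow_pos (Fact.out : p.Prime).pos k, by simpa using hy⟩
  have hz : ‖y / a‖ ≤ 1 := by
    rw [norm_div]
    exact div_le_one_of_le₀ hy (norm_nonneg a)
  let z : ℤ_[p] := ⟨y / a, hz⟩
  refine ⟨z.appr k, z.appr_lt k, ?_⟩
  have h := (PadicInt.norm_le_pow_iff_mem_span_pow _ k).2 (PadicInt.appr_spec k z)
  rw [PadicInt.norm_def] at h
  have hyz : y - z.appr k • a = ((z - z.appr k : ℤ_[p]) : ℚ_[p]) * a := by
    push_cast
    rw [show (z : ℚ_[p]) = y / a from rfl, sub_mul, div_mul_cancel₀ _ ha, nsmul_eq_mul]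
  rw [hyz, norm_mul, nsmul_eq_mul, norm_mul, Nat.cast_pow, Padic.norm_p_pow]
  gcongr

lemma Padic.norm_nsmul_le (n : ℕ) (a : ℚ_[p]) : ‖n • a‖ ≤ ‖a‖ := by
  rw [nsmul_eq_mul, norm_mul]
  exact mul_le_of_le_one_left (norm_nonneg a) (by simpa using Padic.norm_int_le_one (n : ℤ))

lemma Padic.closedBall_sub_mem_iff (c : ℚ_[p]) {b : ℚ_[p]} {r : ℝ} (hb : ‖b‖ ≤ r) (x : ℚ_[p]) :
    x - b ∈ Metric.closedBall c r ↔ x ∈ Metric.closedBall c r := by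
  rw [mem_closedBall_iff_norm, mem_closedBall_iff_norm, sub_right_comm]
  constructor <;> intro h
  · have := IsUltrametricDist.norm_add_le_max (x - c - b) b
    rw [sub_add_cancel] at this
    exact this.trans (max_le h hb)
  · rw [sub_eq_add_neg]
    exact (IsUltrametricDist.norm_add_le_max _ _).trans (max_le h ((norm_neg b).trans_le hb))

/-- Along a translation of `ℚ_p`, Birkhoff sums of length `p ^ k` are nearly constant on balls
on which the summand varies little at scale `‖p ^ k • a‖`. -/
lemma Padic.sum_sub_nsmul_le_add {a c : ℚ_[p]} {φ : ℚ_[p] → ℝ} {k : ℕ} {ε : ℝ}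
    (hφ : ∀ x ∈ Metric.closedBall c ‖a‖, ∀ y ∈ Metric.closedBall c ‖a‖,
      ‖x - y‖ ≤ ‖p ^ k • a‖ → |φ x - φ y| ≤ ε)
    {x y : ℚ_[p]} (hx : x ∈ Metric.closedBall c ‖a‖) (hy : y ∈ Metric.closedBall c ‖a‖) :
    ∑ j ∈ Finset.range (p ^ k), φ (x - j • a)
      ≤ ∑ j ∈ Finset.range (p ^ k), φ (y - j • a) + 2 * (p ^ k : ℕ) * ε := by
  have hmem : ∀ (j : ℕ) {z : ℚ_[p]}, z ∈ Metric.closedBall c ‖a‖ →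
      z - j • a ∈ Metric.closedBall c ‖a‖ := fun j z hz =>
    (Padic.closedBall_sub_mem_iff c (Padic.norm_nsmul_le j a) z).2 hz
  have hε : 0 ≤ ε := (abs_nonneg _).trans (hφ x hx x hx (by rw [sub_self, norm_zero]; positivity))
  obtain ⟨i, hi, hxy⟩ := Padic.exists_nsmul_norm_sub_le (a := a) (y := y - x) (by
    rw [← dist_eq_norm]
    exact (dist_triangle_max y c x).trans
      (max_le hy ((dist_comm c x).trans_le hx))) k
  have hshift : ∀ i : ℕ, ∑ j ∈ Finset.range (p ^ k), φ (y - j • a)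
      ≥ ∑ j ∈ Finset.range (p ^ k), φ (y - i • a - j • a) - i * ε := by
    intro i
    induction i with
    | zero => simp
    | succ i ih =>
      have h1 := Finset.sum_range_succ (fun j => φ (y - i • a - j • a)) (p ^ k)
      rw [Finset.sum_range_succ'] at h1
      have h2 := abs_le.1 (hφ (y - i • a - p ^ k • a) (hmem _ (hmem _ hy))
        (y - i • a - 0 • a) (hmem _ (hmem _ hy)) (by simp [sub_sub_cancel_left]))
      have h3 : ∀ j : ℕ, y - i • a - (j + 1) • a = y - (i + 1) • a - j • a := fun j => by
        simp only [succ_nsmul]; abel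
      simp only [h3] at h1
      push_cast
      linarith [h2.1, h2.2]
  calc ∑ j ∈ Finset.range (p ^ k), φ (x - j • a)
      ≤ ∑ j ∈ Finset.range (p ^ k), (φ (y - i • a - j • a) + ε) := by
        refine Finset.sum_le_sum fun j _ => ?_
        have := abs_le.1 (hφ _ (hmem j (hmem i hy)) _ (hmem j hx)
          (by rwa [sub_sub_sub_cancel_right, sub_right_comm]))
        linarith [this.1]
    _ = ∑ j ∈ Finset.range (p ^ k), φ (y - i • a - j • a) + (p ^ k : ℕ) * ε := by
        rw [Finset.sum_add_distrib]
        simp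
    _ ≤ _ := by
        have hi' : (i : ℝ) ≤ (p ^ k : ℕ) := by exact_mod_cast hi.le
        linarith [hshift i, mul_le_mul_of_nonneg_right hi' hε]

lemma Padic.exists_norm_pow_nsmul_lt (a : ℚ_[p]) {δ : ℝ} (hδ : 0 < δ) :
    ∃ k : ℕ, ‖p ^ k • a‖ < δ := by
  have h : Filter.Tendsto (fun k : ℕ => ‖(p : ℚ_[p])‖ ^ k * ‖a‖) Filter.atTop (nhds (0 * ‖a‖)) :=
    (tendsto_pow_atTop_nhds_zero_of_lt_one (norm_nonneg _) Padic.norm_p_lt_one).mul_const _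
  rw [zero_mul] at h
  obtain ⟨k, hk⟩ := (h.eventually_lt_const hδ).exists
  exact ⟨k, by simpa using hk⟩

/-- A continuous function whose Birkhoff sums along `x ↦ x - a` all take both signs on the ball
`closedBall c ‖a‖` has mean zero there. -/
lemma Padic.setIntegral_closedBall_eq_zero [MeasurableSpace ℚ_[p]] [BorelSpace ℚ_[p]]
    (μ : Measure ℚ_[p]) [μ.IsAddHaarMeasure] {a c : ℚ_[p]} {φ : ℚ_[p] → ℝ} (hφ : Continuous φ)
    (hsign : ∀ N : ℕ, 0 < N →
      (∃ x ∈ Metric.closedBall c ‖a‖, 0 < ∑ j ∈ Finset.range N, φ (x - j • a)) ∧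
        ∃ x ∈ Metric.closedBall c ‖a‖, ∑ j ∈ Finset.range N, φ (x - j • a) < 0) :
    ∫ x in Metric.closedBall c ‖a‖, φ x ∂μ = 0 := by
  set C := Metric.closedBall c ‖a‖ with hCdef
  have hcpt : IsCompact C := isCompact_closedBall c ‖a‖
  have hCm : MeasurableSet C := Metric.isClosed_closedBall.measurableSet
  have hbound : ∀ ε > 0, |∫ x in C, φ x ∂μ| ≤ 2 * ε * μ.real C := by
    intro ε hε
    obtain ⟨δ, hδ, hunif⟩ := Metric.uniformContinuousOn_iff.1
      (hcpt.uniformContinuousOn_of_continuous hφ.continuousOn) ε hε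
    obtain ⟨k, hk⟩ := Padic.exists_norm_pow_nsmul_lt a hδ
    have hosc : ∀ x ∈ C, ∀ y ∈ C, ‖x - y‖ ≤ ‖p ^ k • a‖ → |φ x - φ y| ≤ ε :=
      fun x hx y hy hxy => (hunif x hx y hy (by rw [dist_eq_norm]; exact hxy.trans_lt hk)).le
    have hN : 0 < p ^ k := pow_pos (Fact.out : p.Prime).pos k
    obtain ⟨⟨x, hx, hxpos⟩, y, hy, hyneg⟩ := hsign _ hN
    have hle : ∀ z ∈ C,
        ‖∑ j ∈ Finset.range (p ^ k), φ (z - j • a)‖ ≤ 2 * (p ^ k : ℕ) * ε := by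
      intro z hz
      rw [Real.norm_eq_abs, abs_le]
      constructor
      · linarith [Padic.sum_sub_nsmul_le_add hosc hx hz]
      · linarith [Padic.sum_sub_nsmul_le_add hosc hz hy]
    have h := norm_setIntegral_le_of_norm_le_const (μ := μ) hcpt.measure_lt_top hle
    rw [setIntegral_sum_sub_nsmul hCm (Padic.closedBall_sub_mem_iff c le_rfl)
      (hφ.continuousOn.integrableOn_compact hcpt), norm_mul, Real.norm_natCast,
      Real.norm_eq_abs] at h
    have hN' : (0 : ℝ) < (p ^ k : ℕ) := by exact_mod_cast hN
    refine le_of_mul_le_mul_left (h.trans_eq ?_) hN'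
    ring
  have hlim : Filter.Tendsto (fun ε : ℝ => 2 * ε * μ.real C) (nhdsWithin 0 (Set.Ioi 0))
      (nhds 0) := by
    have : Continuous fun ε : ℝ => 2 * ε * μ.real C := by fun_prop
    simpa using (this.tendsto 0).mono_left nhdsWithin_le_nhds
  have h0 := ge_of_tendsto hlim (Filter.eventually_of_mem self_mem_nhdsWithin hbound)
  exact abs_nonpos_iff.1 h0

lemma Padic.not_isLocallyConstant_of_sum_sub_nsmul {a c : ℚ_[p]} {φ : ℚ_[p] → ℝ}
    (hsign : ∀ N : ℕ, 0 < N →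
      (∃ x ∈ Metric.closedBall c ‖a‖, 0 < ∑ j ∈ Finset.range N, φ (x - j • a)) ∧
        ∃ x ∈ Metric.closedBall c ‖a‖, ∑ j ∈ Finset.range N, φ (x - j • a) < 0) :
    ¬ IsLocallyConstant φ := by
  intro hφ
  obtain ⟨δ, hδ, hball⟩ := lebesgue_number_lemma_of_metric (isCompact_closedBall c ‖a‖)
    (c := fun t : ℝ => φ ⁻¹' {t}) (fun t => hφ {t}) (fun x _ => Set.mem_iUnion.2 ⟨φ x, rfl⟩)
  obtain ⟨k, hk⟩ := Padic.exists_norm_pow_nsmul_lt a hδ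
  have hosc : ∀ x ∈ Metric.closedBall c ‖a‖, ∀ y ∈ Metric.closedBall c ‖a‖,
      ‖x - y‖ ≤ ‖p ^ k • a‖ → |φ x - φ y| ≤ 0 := by
    intro x hx y _ hxy
    obtain ⟨t, ht⟩ := hball x hx
    have h1 : φ x = t := ht (Metric.mem_ball_self hδ)
    have h2 : φ y = t := ht (by
      rw [Metric.mem_ball, dist_comm, dist_eq_norm]; exact hxy.trans_lt hk)
    simp [h1, h2]
  obtain ⟨⟨x, hx, hxpos⟩, y, hy, hyneg⟩ := hsign _ (pow_pos (Fact.out : p.Prime).pos k)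
  linarith [Padic.sum_sub_nsmul_le_add hosc hx hy]

end Padic

/-- An integrable function with zero integral over every closed ball of a fixed positive radius
has zero integral. -/
lemma integral_eq_zero_of_setIntegral_closedBall_eq_zero {E : Type*} [NormedAddCommGroup E]
    [ProperSpace E] [SecondCountableTopology E] [MeasurableSpace E] [BorelSpace E]
    (μ : Measure E) [μ.IsAddHaarMeasure] {φ : E → ℝ} (hφ : Integrable φ μ) {r : ℝ} (hr : 0 < r)
    (h : ∀ c, ∫ x in Metric.closedBall c r, φ x ∂μ = 0) : ∫ x, φ x ∂μ = 0 := by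
  have hBm : MeasurableSet (Metric.closedBall (0 : E) r) := Metric.isClosed_closedBall.measurableSet
  have hBtop : μ (Metric.closedBall (0 : E) r) < ∞ :=
    (isCompact_closedBall (0 : E) r).measure_lt_top
  have hg : Integrable ((Metric.closedBall (0 : E) r).indicator fun _ => (1 : ℝ)) μ :=
    (integrable_indicator_iff hBm).2 (integrableOn_const hBtop.ne)
  have hconv := integral_convolution (ContinuousLinearMap.mul ℝ ℝ) hφ hg
  have hz : ∀ x, convolution φ ((Metric.closedBall (0 : E) r).indicator fun _ => (1 : ℝ))
      (ContinuousLinearMap.mul ℝ ℝ) μ x = 0 := by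
    intro x
    rw [convolution_def, ← h x, ← integral_indicator Metric.isClosed_closedBall.measurableSet]
    congr 1 with t
    by_cases ht : t ∈ Metric.closedBall x r
    · have ht' : x - t ∈ Metric.closedBall (0 : E) r := by
        rwa [mem_closedBall_zero_iff, ← dist_eq_norm, dist_comm]
      simp [Set.indicator_of_mem ht, Set.indicator_of_mem ht']
    · have ht' : x - t ∉ Metric.closedBall (0 : E) r := by
        rwa [mem_closedBall_zero_iff, ← dist_eq_norm, dist_comm]
      simp [Set.indicator_of_notMem ht, Set.indicator_of_notMem ht']
  simp only [hz, integral_zero, ContinuousLinearMap.mul_apply', integral_indicator_const _ hBm,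
    smul_eq_mul, mul_one] at hconv
  have hB0 : μ.real (Metric.closedBall (0 : E) r) ≠ 0 :=
    (ENNReal.toReal_pos (Metric.measure_closedBall_pos μ 0 hr).ne' hBtop.ne).ne'
  exact (mul_eq_zero.1 hconv.symm).resolve_right hB0

/-- If the weighted translation `T_{a,w}` (with `a ≠ 0`) is hypercyclic on
`L^{p'}(ℚ_p)` (Haar measure normalized so that `μ(ℤ_p) = 1`) and `ln ∘ w` is integrable, then
`∫_{ℚ_p} ln w = 0` and `w` is not locally constant. -/
theorem padic_hypercyclic_integral_log_eq_zero_and_not_locallyConstant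
    {p : ℕ} [Fact p.Prime]
    [MeasurableSpace ℚ_[p]] [BorelSpace ℚ_[p]]
    (μ : Measure ℚ_[p]) [μ.IsAddHaarMeasure]
    (hμ : μ {x : ℚ_[p] | ‖x‖ ≤ 1} = 1)
    (a : ℚ_[p]) (ha : a ≠ 0)
    (w : ℚ_[p] → ℝ) (hw_cont : Continuous w) (hw_pos : ∀ x, 0 < w x)
    (hw_bdd : ∃ C : ℝ, ∀ x, w x ≤ C)
    (hw_int : Integrable (fun x => Real.log (w x)) μ)
    (p' : ℝ≥0∞) [Fact (1 ≤ p')] (hp'_top : p' ≠ ∞)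
    (T : Lp ℝ p' μ →L[ℝ] Lp ℝ p' μ)
    (hT : ∀ f : Lp ℝ p' μ, (T f : ℚ_[p] → ℝ) =ᵐ[μ] fun x => w x * f (x - a))
    (hhyp : ∃ f : Lp ℝ p' μ, Dense (Set.range fun n : ℕ => ((T ^ n) f))) :
    ∫ x, Real.log (w x) ∂μ = 0 ∧ ¬ IsLocallyConstant w := by
  have hsign : ∀ (c : ℚ_[p]) (N : ℕ), 0 < N →
      (∃ x ∈ Metric.closedBall c ‖a‖, 0 < ∑ j ∈ Finset.range N, Real.log (w (x - j • a))) ∧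
        ∃ x ∈ Metric.closedBall c ‖a‖, ∑ j ∈ Finset.range N, Real.log (w (x - j • a)) < 0 := by
    intro c N hN
    have hlog : ∀ x, ∑ j ∈ Finset.range N, Real.log (w (x - j • a))
        = Real.log (∏ j ∈ Finset.range N, w (x - j • a)) := fun x =>
      (Real.log_prod fun j _ => (hw_pos _).ne').symm
    obtain ⟨⟨x, hx, hx1⟩, y, hy, hy1⟩ := exists_prod_gt_and_lt_of_dense_orbit (μ := μ) hT hw_pos hhyp
      (C := Metric.closedBall c ‖a‖) Metric.isClosed_closedBall.measurableSet
      (Padic.closedBall_sub_mem_iff c le_rfl)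
      (Metric.measure_closedBall_pos μ c (norm_pos_iff.2 ha)).ne'
      (isCompact_closedBall c ‖a‖).measure_lt_top.ne hN
    refine ⟨⟨x, hx, ?_⟩, y, hy, ?_⟩
    · rw [hlog]
      exact Real.log_pos hx1
    · rw [hlog]
      exact Real.log_neg (Finset.prod_pos fun j _ => hw_pos _) hy1
  refine ⟨integral_eq_zero_of_setIntegral_closedBall_eq_zero μ hw_int (norm_pos_iff.2 ha)
    fun c => Padic.setIntegral_closedBall_eq_zero μ
      (hw_cont.log fun x => (hw_pos x).ne') (hsign c), fun hw => ?_⟩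
  exact Padic.not_isLocallyConstant_of_sum_sub_nsmul (hsign 0) (hw.comp Real.log)
end
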